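/- Assume the deterministic events ‖W‖ ≤ √(nd)+√m+√(2γ log n) and max_{1≤i≤n} ‖W_i A^T‖ ≤ (2√d+√(2γ log n))‖A‖ hold, let ε = 1/(32κ²√d) and ξ = 6, and assume σ ≤ (ε²d/(6κ²))·√n‖A‖/(√d·(√(nd)+√m+√(2γ n log n))). Then for every S ∈ N_{ξ,∞} and every 1 ≤ i ≤ n, ‖Δ_i^T S‖_F ≤ 3√(nd)·(√(nd)+√m+√(2γ n log n))·‖A‖, and consequently σ‖Δ_i^T S‖_F ≤ ε²dn‖A‖²/(2κ²). -/

import Mathlib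

open MeasureTheory Matrix Filter

namespace GOPP

/-- Frobenius norm of a real matrix. -/
noncomputable def frob {α β : Type*} [Fintype α] [Fintype β] (X : Matrix α β ℝ) : ℝ :=
  Real.sqrt (∑ i, ∑ j, X i j ^ 2)

/-- Euclidean norm of a vector. -/
noncomputable def vnorm {β : Type*} [Fintype β] (v : β → ℝ) : ℝ :=
  Real.sqrt (∑ j, v j ^ 2)

/-- Operator (spectral) norm: the supremum of ‖Xu‖ over unit vectors u. -/
noncomputable def opNorm {α β : Type*} [Fintype α] [Fintype β] (X : Matrix α β ℝ) : ℝ :=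
  sSup {r : ℝ | ∃ u : β → ℝ, vnorm u = 1 ∧ r = vnorm (X.mulVec u)}

/-- Smallest singular value: the infimum of ‖uᵀX‖ over unit vectors u (for a d×m matrix
with d ≤ m this is the d-th largest singular value; for square matrices it is σ_min). -/
noncomputable def sigmaMin {α β : Type*} [Fintype α] [Fintype β] (X : Matrix α β ℝ) : ℝ :=
  sInf {r : ℝ | ∃ u : α → ℝ, vnorm u = 1 ∧ r = vnorm (Matrix.vecMul u X)}

/-- Condition number κ = σ_max/σ_min. -/
noncomputable def kappa {d m : ℕ} (A : Matrix (Fin d) (Fin m) ℝ) : ℝ :=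
  opNorm A / sigmaMin A

/-- Q is an orthogonal matrix. -/
def IsOrth {d : ℕ} (Q : Matrix (Fin d) (Fin d) ℝ) : Prop :=
  Qᵀ * Q = 1 ∧ Q * Qᵀ = 1

/-- Nuclear norm, via the dual characterization ‖M‖_* = max_{Q ∈ O(d)} ⟨Q, M⟩. -/
noncomputable def nuclearNorm {d : ℕ} (M : Matrix (Fin d) (Fin d) ℝ) : ℝ :=
  sSup {r : ℝ | ∃ Q : Matrix (Fin d) (Fin d) ℝ, IsOrth Q ∧ r = Matrix.trace (Qᵀ * M)}

/-- The i-th d×k block of an (nd)×k block matrix. -/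
def blk {n d k : ℕ} (S : Matrix (Fin n × Fin d) (Fin k) ℝ) (i : Fin n) :
    Matrix (Fin d) (Fin k) ℝ :=
  Matrix.of fun a b => S (i, a) b

/-- The i-th diagonal d×d block of an (nd)×(nd) matrix. -/
def dblk {n d : ℕ} (G : Matrix (Fin n × Fin d) (Fin n × Fin d) ℝ) (i : Fin n) :
    Matrix (Fin d) (Fin d) ℝ :=
  Matrix.of fun a b => G (i, a) (i, b)

/-- S ∈ O(d)^{⊗n}: each of the n d×d blocks of S is orthogonal. -/
def OrthBlocks {n d : ℕ} (S : Matrix (Fin n × Fin d) (Fin d) ℝ) : Prop :=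
  ∀ i, IsOrth (blk S i)

/-- Z ∈ ℝ^{nd×d}: the vertical stack of n copies of I_d. -/
def ZStack (n d : ℕ) : Matrix (Fin n × Fin d) (Fin d) ℝ :=
  Matrix.of fun p j => if p.2 = j then 1 else 0

/-- Vertical stack of n given d×k matrices. -/
def stack {n d k : ℕ} (B : Fin n → Matrix (Fin d) (Fin k) ℝ) :
    Matrix (Fin n × Fin d) (Fin k) ℝ :=
  Matrix.of fun p b => B p.1 p.2 b

/-- d_F(X,Y) = min_{Q ∈ O(d)} ‖X − YQ‖_F. -/
noncomputable def dF {n d : ℕ} (X Y : Matrix (Fin n × Fin d) (Fin d) ℝ) : ℝ :=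
  sInf {r : ℝ | ∃ Q, IsOrth Q ∧ r = frob (X - Y * Q)}

/-- R is a polar factor P(X) of X: an orthogonal global minimizer of ‖X − Q‖_F over O(d). -/
def IsPolar {d : ℕ} (X R : Matrix (Fin d) (Fin d) ℝ) : Prop :=
  IsOrth R ∧ ∀ Q : Matrix (Fin d) (Fin d) ℝ, IsOrth Q → frob (X - R) ≤ frob (X - Q)

/-- S = P_n(X): blockwise polar factor. -/
def IsPolarBlocks {n d : ℕ} (X S : Matrix (Fin n × Fin d) (Fin d) ℝ) : Prop :=
  ∀ i, IsPolar (blk X i) (blk S i)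

/-- U collects (an orthonormal basis of the span of) the top d left singular vectors of D:
U has orthonormal columns and maximizes the Ky Fan quantity trace(Uᵀ(DDᵀ)U). -/
def IsTopSingVecs {N : Type*} [Fintype N] {d m : ℕ} (D : Matrix N (Fin m) ℝ)
    (U : Matrix N (Fin d) ℝ) : Prop :=
  Uᵀ * U = 1 ∧ ∀ Q : Matrix N (Fin d) ℝ, Qᵀ * Q = 1 →
    Matrix.trace (Qᵀ * (D * Dᵀ) * Q) ≤ Matrix.trace (Uᵀ * (D * Dᵀ) * U)

/-- (U, S, V) is a top-d singular triple of D: orthonormal U, V, diagonal nonnegative S,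
DV = US, DᵀU = VS, and U spans a top-d left singular subspace. -/
def IsSVDTriple {N : Type*} [Fintype N] {d m : ℕ} (D : Matrix N (Fin m) ℝ)
    (U : Matrix N (Fin d) ℝ) (S : Matrix (Fin d) (Fin d) ℝ)
    (V : Matrix (Fin m) (Fin d) ℝ) : Prop :=
  Vᵀ * V = 1 ∧ (∀ a b, a ≠ b → S a b = 0) ∧ (∀ a, 0 ≤ S a a) ∧
    D * V = U * S ∧ Dᵀ * U = V * S ∧ IsTopSingVecs D U

/-- The generalized power method sequence with spectral initialization, run on the data
matrix D (so with C = DDᵀ): S⁰ = P_n(U) for top singular vectors U of D, and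
S^{t+1} = P_n(C Sᵗ). -/
def IsGPM {n d m : ℕ} (D : Matrix (Fin n × Fin d) (Fin m) ℝ)
    (S : ℕ → Matrix (Fin n × Fin d) (Fin d) ℝ) : Prop :=
  (∃ U, IsTopSingVecs D U ∧ IsPolarBlocks U (S 0)) ∧
    ∀ t, IsPolarBlocks (D * Dᵀ * S t) (S (t + 1))

/-- W^(i): W with its i-th block row replaced by 0. -/
def mask {n d m : ℕ} (W : Matrix (Fin n × Fin d) (Fin m) ℝ) (i : Fin n) :
    Matrix (Fin n × Fin d) (Fin m) ℝ :=
  Matrix.of fun p b => if p.1 = i then 0 else W p b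

/-- The noise matrix Δ = WAᵀZᵀ + ZAWᵀ + σWWᵀ. -/
noncomputable def delta {n d m : ℕ} (A : Matrix (Fin d) (Fin m) ℝ)
    (W : Matrix (Fin n × Fin d) (Fin m) ℝ) (σ : ℝ) :
    Matrix (Fin n × Fin d) (Fin n × Fin d) ℝ :=
  W * Aᵀ * (ZStack n d)ᵀ + ZStack n d * A * Wᵀ + σ • (W * Wᵀ)

/-- The i-th block column Δ_i = WAᵀ + ZAW_iᵀ + σWW_iᵀ of Δ. -/
noncomputable def deltaCol {n d m : ℕ} (A : Matrix (Fin d) (Fin m) ℝ)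
    (W : Matrix (Fin n × Fin d) (Fin m) ℝ) (σ : ℝ) (i : Fin n) :
    Matrix (Fin n × Fin d) (Fin d) ℝ :=
  W * Aᵀ + ZStack n d * A * (blk W i)ᵀ + σ • (W * (blk W i)ᵀ)

/-- The operator L S = C S/(n‖A‖²) with C = ZAAᵀZᵀ + σΔ. -/
noncomputable def Lop {n d m : ℕ} (A : Matrix (Fin d) (Fin m) ℝ)
    (W : Matrix (Fin n × Fin d) (Fin m) ℝ) (σ : ℝ)
    (S : Matrix (Fin n × Fin d) (Fin d) ℝ) : Matrix (Fin n × Fin d) (Fin d) ℝ :=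
  ((n : ℝ) * opNorm A ^ 2)⁻¹ •
    ((ZStack n d * A * Aᵀ * (ZStack n d)ᵀ + σ • delta A W σ) * S)

/-- √(nd) + √m + √(2γ n log n). -/
noncomputable def bnd1 (n d m : ℕ) (γ : ℝ) : ℝ :=
  Real.sqrt ((n : ℝ) * d) + Real.sqrt (m : ℝ) + Real.sqrt (2 * γ * n * Real.log n)

/-- √(nd) + √m + √(2γ log n). -/
noncomputable def bnd2 (n d m : ℕ) (γ : ℝ) : ℝ :=
  Real.sqrt ((n : ℝ) * d) + Real.sqrt (m : ℝ) + Real.sqrt (2 * γ * Real.log n)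

/-- The basin of attraction N_ε. -/
def memNeps {n d : ℕ} (ε : ℝ) (S : Matrix (Fin n × Fin d) (Fin d) ℝ) : Prop :=
  OrthBlocks S ∧ dF S (ZStack n d) ≤ ε * Real.sqrt ((n : ℝ) * d)

/-- The basin of attraction N_{ξ,∞}. -/
def memNxi {n d m : ℕ} (W : Matrix (Fin n × Fin d) (Fin m) ℝ) (γ ξ : ℝ)
    (S : Matrix (Fin n × Fin d) (Fin d) ℝ) : Prop :=
  OrthBlocks S ∧ ∀ i, frob (blk W i * Wᵀ * S) ≤ ξ * Real.sqrt (d : ℝ) * bnd1 n d m γ ^ 2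

/-- The distribution of a matrix with i.i.d. standard Gaussian N(0,1) entries. -/
noncomputable def stdGaussian (ι κ : Type*) [Fintype ι] [Fintype κ] :
    Measure (ι → κ → ℝ) :=
  Measure.pi fun _ : ι => Measure.pi fun _ : κ => ProbabilityTheory.gaussianReal 0 1

open scoped Matrix.Norms.Frobenius in
theorem frob_eq_norm {α β : Type*} [Fintype α] [Fintype β] (X : Matrix α β ℝ) :
    frob X = ‖X‖ := by
  rw [frob, Matrix.frobenius_norm_def, Real.sqrt_eq_rpow]
  simp

theorem frob_nonneg {α β : Type*} [Fintype α] [Fintype β] (X : Matrix α β ℝ) : 0 ≤ frob X :=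
  Real.sqrt_nonneg _

open scoped Matrix.Norms.Frobenius in
theorem frob_add_le {α β : Type*} [Fintype α] [Fintype β] (X Y : Matrix α β ℝ) :
    frob (X + Y) ≤ frob X + frob Y := by
  simpa only [frob_eq_norm] using norm_add_le X Y

open scoped Matrix.Norms.Frobenius in
theorem frob_sum_le {ι α β : Type*} [Fintype α] [Fintype β] (s : Finset ι)
    (X : ι → Matrix α β ℝ) : frob (∑ i ∈ s, X i) ≤ ∑ i ∈ s, frob (X i) := by
  simpa only [frob_eq_norm] using norm_sum_le s X

open scoped Matrix.Norms.Frobenius in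
theorem frob_smul {α β : Type*} [Fintype α] [Fintype β] (c : ℝ) (X : Matrix α β ℝ) :
    frob (c • X) = |c| * frob X := by
  simpa only [frob_eq_norm, Real.norm_eq_abs] using norm_smul c X

theorem vnorm_nonneg {β : Type*} [Fintype β] (v : β → ℝ) : 0 ≤ vnorm v :=
  Real.sqrt_nonneg _

theorem vnorm_sq {β : Type*} [Fintype β] (v : β → ℝ) : vnorm v ^ 2 = ∑ j, v j ^ 2 :=
  Real.sq_sqrt (Finset.sum_nonneg fun _ _ => sq_nonneg _)

theorem vnorm_sq_eq_dotProduct {β : Type*} [Fintype β] (v : β → ℝ) : vnorm v ^ 2 = v ⬝ᵥ v := by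
  rw [vnorm_sq]
  simp only [dotProduct, sq]

theorem vnorm_smul {β : Type*} [Fintype β] (c : ℝ) (v : β → ℝ) :
    vnorm (c • v) = |c| * vnorm v := by
  simp only [vnorm, Pi.smul_apply, smul_eq_mul, mul_pow, ← Finset.mul_sum]
  rw [Real.sqrt_mul (sq_nonneg c), Real.sqrt_sq_eq_abs]

theorem eq_zero_of_vnorm_eq_zero {β : Type*} [Fintype β] {v : β → ℝ} (h : vnorm v = 0) :
    v = 0 := by
  rw [← dotProduct_self_eq_zero, ← vnorm_sq_eq_dotProduct, h]
  norm_num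

theorem vnorm_zero {β : Type*} [Fintype β] : vnorm (0 : β → ℝ) = 0 := by
  simp [vnorm]

theorem dotProduct_le_vnorm_mul_vnorm {β : Type*} [Fintype β] (u v : β → ℝ) :
    u ⬝ᵥ v ≤ vnorm u * vnorm v :=
  Real.sum_mul_le_sqrt_mul_sqrt _ _ _

theorem frob_sq {α β : Type*} [Fintype α] [Fintype β] (X : Matrix α β ℝ) :
    frob X ^ 2 = ∑ i, ∑ j, X i j ^ 2 :=
  Real.sq_sqrt (Finset.sum_nonneg fun _ _ => Finset.sum_nonneg fun _ _ => sq_nonneg _)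

theorem vnorm_mulVec_le_frob {α β : Type*} [Fintype α] [Fintype β] (X : Matrix α β ℝ)
    (u : β → ℝ) : vnorm (X *ᵥ u) ≤ frob X * vnorm u := by
  refine abs_le_of_sq_le_sq' ?_ (mul_nonneg (frob_nonneg X) (vnorm_nonneg u)) |>.2
  rw [mul_pow, vnorm_sq, vnorm_sq, frob_sq, Finset.sum_mul]
  exact Finset.sum_le_sum fun i _ => Finset.sum_mul_sq_le_sq_mul_sq _ _ _

theorem opNorm_nonneg {α β : Type*} [Fintype α] [Fintype β] (X : Matrix α β ℝ) :
    0 ≤ opNorm X := by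
  refine Real.sSup_nonneg ?_
  rintro r ⟨u, -, rfl⟩
  exact vnorm_nonneg _

theorem vnorm_mulVec_le {α β : Type*} [Fintype α] [Fintype β] (X : Matrix α β ℝ)
    (u : β → ℝ) : vnorm (X *ᵥ u) ≤ opNorm X * vnorm u := by
  rcases (vnorm_nonneg u).eq_or_lt with h | h
  · simp [eq_zero_of_vnorm_eq_zero h.symm, vnorm_zero]
  have hbdd : BddAbove {r : ℝ | ∃ u : β → ℝ, vnorm u = 1 ∧ r = vnorm (X *ᵥ u)} := by
    refine ⟨frob X, ?_⟩
    rintro r ⟨v, hv, rfl⟩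
    simpa [hv] using vnorm_mulVec_le_frob X v
  have hle : vnorm (X *ᵥ ((vnorm u)⁻¹ • u)) ≤ opNorm X := by
    refine le_csSup hbdd ⟨_, ?_, rfl⟩
    rw [vnorm_smul, abs_of_pos (inv_pos.2 h), inv_mul_cancel₀ h.ne']
  rwa [Matrix.mulVec_smul, vnorm_smul, abs_of_pos (inv_pos.2 h), inv_mul_le_iff₀' h] at hle

theorem vnorm_transpose_mulVec_le {α β : Type*} [Fintype α] [Fintype β] (X : Matrix α β ℝ)
    (u : α → ℝ) : vnorm (Xᵀ *ᵥ u) ≤ opNorm X * vnorm u := by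
  rcases (vnorm_nonneg (Xᵀ *ᵥ u)).eq_or_lt with h | h
  · rw [← h]
    exact mul_nonneg (opNorm_nonneg X) (vnorm_nonneg u)
  have hsq : vnorm (Xᵀ *ᵥ u) ^ 2 = u ⬝ᵥ (X *ᵥ (Xᵀ *ᵥ u)) := by
    rw [vnorm_sq_eq_dotProduct, Matrix.dotProduct_mulVec u, ← Matrix.mulVec_transpose]
  have h1 := dotProduct_le_vnorm_mul_vnorm u (X *ᵥ (Xᵀ *ᵥ u))
  have h2 := mul_le_mul_of_nonneg_left (vnorm_mulVec_le X (Xᵀ *ᵥ u)) (vnorm_nonneg u)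
  refine le_of_mul_le_mul_right ?_ h
  linarith

theorem frob_sq_eq_sum_vnorm_sq {α β : Type*} [Fintype α] [Fintype β] (X : Matrix α β ℝ) :
    frob X ^ 2 = ∑ j, vnorm (fun i => X i j) ^ 2 := by
  simp only [frob_sq, vnorm_sq]
  exact Finset.sum_comm

theorem frob_mul_le_of_vnorm_mulVec_le {α β δ : Type*} [Fintype α] [Fintype β] [Fintype δ]
    {X : Matrix α β ℝ} {c : ℝ} (hc : 0 ≤ c) (h : ∀ u, vnorm (X *ᵥ u) ≤ c * vnorm u)
    (Y : Matrix β δ ℝ) : frob (X * Y) ≤ c * frob Y := by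
  refine abs_le_of_sq_le_sq' ?_ (mul_nonneg hc (frob_nonneg Y)) |>.2
  rw [mul_pow, frob_sq_eq_sum_vnorm_sq, frob_sq_eq_sum_vnorm_sq, Finset.mul_sum]
  refine Finset.sum_le_sum fun j _ => ?_
  rw [← mul_pow]
  exact pow_le_pow_left₀ (vnorm_nonneg _) (h fun k => Y k j) 2

theorem frob_mul_le {α β δ : Type*} [Fintype α] [Fintype β] [Fintype δ]
    (X : Matrix α β ℝ) (Y : Matrix β δ ℝ) : frob (X * Y) ≤ opNorm X * frob Y :=
  frob_mul_le_of_vnorm_mulVec_le (opNorm_nonneg X) (vnorm_mulVec_le X) Y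

theorem frob_transpose_mul_le {α β δ : Type*} [Fintype α] [Fintype β] [Fintype δ]
    (X : Matrix α β ℝ) (Y : Matrix α δ ℝ) : frob (Xᵀ * Y) ≤ opNorm X * frob Y :=
  frob_mul_le_of_vnorm_mulVec_le (opNorm_nonneg X) (vnorm_transpose_mulVec_le X) Y

theorem sigmaMin_le_opNorm {d m : ℕ} (hd : 1 ≤ d) (A : Matrix (Fin d) (Fin m) ℝ) :
    sigmaMin A ≤ opNorm A := by
  have hunit : vnorm (Pi.single (⟨0, hd⟩ : Fin d) (1 : ℝ)) = 1 := by
    rw [← sq_eq_sq₀ (vnorm_nonneg _) zero_le_one, vnorm_sq_eq_dotProduct]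
    simp
  calc sigmaMin A ≤ vnorm (Pi.single (⟨0, hd⟩ : Fin d) (1 : ℝ) ᵥ* A) := by
        refine csInf_le ⟨0, ?_⟩ ⟨_, hunit, rfl⟩
        rintro r ⟨u, -, rfl⟩
        exact vnorm_nonneg _
    _ ≤ opNorm A := by
        simpa [hunit, Matrix.mulVec_transpose] using
          vnorm_transpose_mulVec_le A (Pi.single (⟨0, hd⟩ : Fin d) (1 : ℝ))

theorem one_le_kappa {d m : ℕ} (hd : 1 ≤ d) {A : Matrix (Fin d) (Fin m) ℝ}
    (hA : 0 < sigmaMin A) : 1 ≤ kappa A :=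
  (one_le_div hA).2 (sigmaMin_le_opNorm hd A)

theorem IsOrth.frob_sq {d : ℕ} {Q : Matrix (Fin d) (Fin d) ℝ} (hQ : IsOrth Q) :
    frob Q ^ 2 = d := by
  have h := congrArg Matrix.trace hQ.2
  rw [Matrix.trace_one, Fintype.card_fin] at h
  rw [GOPP.frob_sq, ← h]
  simp [Matrix.trace, Matrix.mul_apply, sq]

theorem IsOrth.frob_eq {d : ℕ} {Q : Matrix (Fin d) (Fin d) ℝ} (hQ : IsOrth Q) :
    frob Q = √d := by
  rw [← hQ.frob_sq, Real.sqrt_sq (frob_nonneg Q)]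

theorem OrthBlocks.frob_eq {n d : ℕ} {S : Matrix (Fin n × Fin d) (Fin d) ℝ}
    (hS : OrthBlocks S) : frob S = √((n : ℝ) * d) := by
  rw [frob, Fintype.sum_prod_type]
  congr 1
  calc _ = ∑ i, frob (blk S i) ^ 2 := by simp only [frob_sq, blk, Matrix.of_apply]
    _ = n * d := by simp [fun i => (hS i).frob_sq]

theorem transpose_ZStack_mul {n d : ℕ} (S : Matrix (Fin n × Fin d) (Fin d) ℝ) :
    (ZStack n d)ᵀ * S = ∑ i, blk S i := by
  ext a b
  simp [Matrix.mul_apply, Matrix.sum_apply, ZStack, blk, Fintype.sum_prod_type]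

theorem OrthBlocks.frob_transpose_ZStack_mul_le {n d : ℕ}
    {S : Matrix (Fin n × Fin d) (Fin d) ℝ} (hS : OrthBlocks S) :
    frob ((ZStack n d)ᵀ * S) ≤ n * √d := by
  rw [transpose_ZStack_mul]
  refine (frob_sum_le _ _).trans_eq ?_
  simp [fun i => (hS i).frob_eq]

theorem transpose_deltaCol_mul {n d m : ℕ} (A : Matrix (Fin d) (Fin m) ℝ)
    (W : Matrix (Fin n × Fin d) (Fin m) ℝ) (σ : ℝ) (i : Fin n)
    (S : Matrix (Fin n × Fin d) (Fin d) ℝ) :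
    (deltaCol A W σ i)ᵀ * S =
      A * (Wᵀ * S) + blk W i * Aᵀ * ((ZStack n d)ᵀ * S) + σ • (blk W i * Wᵀ * S) := by
  simp only [deltaCol, Matrix.transpose_add, Matrix.transpose_mul, Matrix.transpose_smul,
    Matrix.transpose_transpose, Matrix.add_mul, Matrix.smul_mul, Matrix.mul_assoc]

theorem frob_transpose_deltaCol_mul_le {n d m : ℕ} (A : Matrix (Fin d) (Fin m) ℝ)
    (W : Matrix (Fin n × Fin d) (Fin m) ℝ) {σ : ℝ} (hσ : 0 ≤ σ) (i : Fin n)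
    {S : Matrix (Fin n × Fin d) (Fin d) ℝ} (hS : OrthBlocks S) :
    frob ((deltaCol A W σ i)ᵀ * S) ≤ opNorm A * (opNorm W * √((n : ℝ) * d)) +
      opNorm (blk W i * Aᵀ) * (n * √d) + σ * frob (blk W i * Wᵀ * S) := by
  rw [transpose_deltaCol_mul]
  refine (frob_add_le _ _).trans (add_le_add ((frob_add_le _ _).trans (add_le_add ?_ ?_)) ?_)
  · refine (frob_mul_le _ _).trans (mul_le_mul_of_nonneg_left ?_ (opNorm_nonneg A))
    rw [← hS.frob_eq]
    exact frob_transpose_mul_le W S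
  · exact (frob_mul_le _ _).trans
      (mul_le_mul_of_nonneg_left hS.frob_transpose_ZStack_mul_le (opNorm_nonneg _))
  · rw [frob_smul, abs_of_nonneg hσ]

theorem sqrt_le_sqrt_add_sqrt_log {n m : ℕ} (hn : 1 ≤ n) (hm : 1 ≤ m) {γ : ℝ} (hγ : 2 ≤ γ) :
    √(n : ℝ) ≤ √(m : ℝ) + √(2 * γ * n * Real.log n) := by
  rcases hn.eq_or_lt with rfl | hn
  · have : √((1 : ℕ) : ℝ) ≤ √(m : ℝ) := Real.sqrt_le_sqrt (by exact_mod_cast hm)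
    linarith [Real.sqrt_nonneg (2 * γ * (1 : ℕ) * Real.log (1 : ℕ))]
  · have hlog : 1 / 2 ≤ Real.log n :=
      (by linarith [Real.log_two_gt_d9] : 1 / 2 ≤ Real.log 2).trans
        (Real.log_le_log two_pos (by exact_mod_cast hn))
    have hmul : 1 ≤ 2 * γ * Real.log n := by nlinarith
    have : √(n : ℝ) ≤ √(2 * γ * n * Real.log n) := by
      refine Real.sqrt_le_sqrt ?_
      nlinarith [Nat.cast_nonneg (α := ℝ) n]
    linarith [Real.sqrt_nonneg (m : ℝ)]

theorem bnd1_pos {n d m : ℕ} (hm : 1 ≤ m) (γ : ℝ) : 0 < bnd1 n d m γ := by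
  have : 0 < √(m : ℝ) := Real.sqrt_pos.2 (by exact_mod_cast hm)
  unfold bnd1
  positivity

/-- Proposition 5.5, first part: bound on ‖Δᵢᵀ S‖_F for S ∈ N_{ξ,∞}. -/
theorem deltaCol_bound (n d m : ℕ) (hn : 1 ≤ n) (hd : 1 ≤ d) (hm : d ≤ m)
    (A : Matrix (Fin d) (Fin m) ℝ) (hA : 0 < sigmaMin A)
    (W : Matrix (Fin n × Fin d) (Fin m) ℝ) (σ γ : ℝ) (hσ : 0 < σ) (hγ : 2 ≤ γ)
    (hW : opNorm W ≤ bnd2 n d m γ)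
    (hWA : ∀ i, opNorm (blk W i * Aᵀ) ≤
      (2 * Real.sqrt (d : ℝ) + Real.sqrt (2 * γ * Real.log n)) * opNorm A)
    (ε ξ : ℝ) (hε : ε = 1 / (32 * kappa A ^ 2 * Real.sqrt (d : ℝ))) (hξ : ξ = 6)
    (hσ2 : σ ≤ ε ^ 2 * (d : ℝ) / (6 * kappa A ^ 2) *
      (Real.sqrt (n : ℝ) * opNorm A) / (Real.sqrt (d : ℝ) * bnd1 n d m γ)) :
    ∀ S : Matrix (Fin n × Fin d) (Fin d) ℝ, memNxi W γ ξ S → ∀ i,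
      frob ((deltaCol A W σ i)ᵀ * S) ≤
        3 * Real.sqrt ((n : ℝ) * d) * bnd1 n d m γ * opNorm A ∧
      σ * frob ((deltaCol A W σ i)ᵀ * S) ≤
        ε ^ 2 * (d : ℝ) * n * opNorm A ^ 2 / (2 * kappa A ^ 2) := by
  intro S ⟨hS, hSξ⟩ i
  have hκ : 1 ≤ kappa A := one_le_kappa hd hA
  have hB : 0 < bnd1 n d m γ := bnd1_pos (hd.trans hm) γ
  have ha : 0 ≤ opNorm A := opNorm_nonneg A
  have hs : 1 ≤ √(d : ℝ) := Real.one_le_sqrt.2 (by exact_mod_cast hd)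
  have hs2 : √(d : ℝ) ^ 2 = d := Real.sq_sqrt (Nat.cast_nonneg d)
  have ht2 : √(n : ℝ) ^ 2 = n := Real.sq_sqrt (Nat.cast_nonneg n)
  have hnd : √((n : ℝ) * d) = √(n : ℝ) * √(d : ℝ) := Real.sqrt_mul (Nat.cast_nonneg n) _
  have hlog : √(2 * γ * n * Real.log n) = √(n : ℝ) * √(2 * γ * Real.log n) := by
    rw [← Real.sqrt_mul (Nat.cast_nonneg n)]
    ring_nf
  have hkey := sqrt_le_sqrt_add_sqrt_log hn (hd.trans hm) hγ
  have ht : 1 ≤ √(n : ℝ) := Real.one_le_sqrt.2 (by exact_mod_cast hn)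
  have hl : 0 ≤ √(2 * γ * Real.log n) := Real.sqrt_nonneg _
  have hr : 0 ≤ √(m : ℝ) := Real.sqrt_nonneg _
  have hB1 : bnd1 n d m γ = √(n : ℝ) * √(d : ℝ) + √(m : ℝ) + √(n : ℝ) * √(2 * γ * Real.log n) := by
    rw [bnd1, hnd, hlog]
  have hB2 : bnd2 n d m γ = √(n : ℝ) * √(d : ℝ) + √(m : ℝ) + √(2 * γ * Real.log n) := by
    rw [bnd2, hnd]
  rw [hlog] at hkey
  have hεd : ε ^ 2 * d = 1 / (1024 * kappa A ^ 4) := by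
    rw [hε, div_pow, mul_pow, hs2]
    field_simp
    norm_num
  have hσB : σ * (√(d : ℝ) * bnd1 n d m γ) ≤
      ε ^ 2 * (d : ℝ) / (6 * kappa A ^ 2) * (√(n : ℝ) * opNorm A) :=
    (le_div_iff₀ (by positivity)).1 hσ2
  have hquad : σ * frob (blk W i * Wᵀ * S) ≤
      (√(n : ℝ) * opNorm A) * bnd1 n d m γ / 1024 := by
    have hcoef : ε ^ 2 * (d : ℝ) / (6 * kappa A ^ 2) ≤ 1 / 6144 := by
      rw [hεd, div_div, show 1024 * kappa A ^ 4 * (6 * kappa A ^ 2) = 6144 * kappa A ^ 6 by ring]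
      refine one_div_le_one_div_of_le (by norm_num) ?_
      linarith [one_le_pow₀ hκ (n := 6)]
    calc σ * frob (blk W i * Wᵀ * S) ≤ σ * (6 * √(d : ℝ) * bnd1 n d m γ ^ 2) :=
          mul_le_mul_of_nonneg_left (hξ ▸ hSξ i) hσ.le
      _ = 6 * bnd1 n d m γ * (σ * (√(d : ℝ) * bnd1 n d m γ)) := by ring
      _ ≤ 6 * bnd1 n d m γ * (1 / 6144 * (√(n : ℝ) * opNorm A)) := by
          refine mul_le_mul_of_nonneg_left ?_ (by positivity)
          exact hσB.trans (mul_le_mul_of_nonneg_right hcoef (by positivity))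
      _ = _ := by ring
  have hmain : frob ((deltaCol A W σ i)ᵀ * S) ≤
      3 * √((n : ℝ) * d) * bnd1 n d m γ * opNorm A := by
    have h1 : opNorm A * (opNorm W * √((n : ℝ) * d)) ≤
        opNorm A * (bnd2 n d m γ * √((n : ℝ) * d)) := by gcongr
    have h2 : opNorm (blk W i * Aᵀ) * (n * √(d : ℝ)) ≤
        (2 * √(d : ℝ) + √(2 * γ * Real.log n)) * opNorm A * (n * √(d : ℝ)) := by
      gcongr
      exact hWA i
    refine ((frob_transpose_deltaCol_mul_le A W hσ.le i hS).trans
      (add_le_add_three h1 h2 hquad)).trans ?_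
    rw [hB1, hB2, hnd]
    generalize √(n : ℝ) = t at *
    generalize √(d : ℝ) = s at *
    generalize √(m : ℝ) = r at *
    generalize √(2 * γ * Real.log n) = l at *
    have hl1 : l ≤ t * l := le_mul_of_one_le_left hl ht
    have hscale : t * s + r + t * l ≤ s * (2 * r + 2 * (t * l)) := by
      nlinarith [mul_le_mul_of_nonneg_left hkey (zero_le_one.trans hs),
        mul_nonneg (sub_nonneg.2 hs) hr,
        mul_nonneg (sub_nonneg.2 hs) (hl.trans hl1)]
    have hinner : s * (t * s + r + l) + s * (2 * (t * s) + t * l) + (t * s + r + t * l) / 1024 ≤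
        3 * s * (t * s + r + t * l) := by
      nlinarith [mul_le_mul_of_nonneg_left hl1 (zero_le_one.trans hs),
        mul_nonneg (zero_le_one.trans hs) hr,
        mul_nonneg (zero_le_one.trans hs) (hl.trans hl1)]
    have := mul_le_mul_of_nonneg_left hinner (mul_nonneg (zero_le_one.trans ht) ha)
    rw [← ht2]
    linarith
  refine ⟨hmain, ?_⟩
  calc σ * frob ((deltaCol A W σ i)ᵀ * S)
      ≤ σ * (3 * √((n : ℝ) * d) * bnd1 n d m γ * opNorm A) :=
        mul_le_mul_of_nonneg_left hmain hσ.le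
    _ = 3 * √(n : ℝ) * opNorm A * (σ * (√(d : ℝ) * bnd1 n d m γ)) := by rw [hnd]; ring
    _ ≤ 3 * √(n : ℝ) * opNorm A *
        (ε ^ 2 * (d : ℝ) / (6 * kappa A ^ 2) * (√(n : ℝ) * opNorm A)) := by gcongr
    _ = ε ^ 2 * (d : ℝ) * √(n : ℝ) ^ 2 * opNorm A ^ 2 / (2 * kappa A ^ 2) := by ring
    _ = _ := by rw [ht2]

end GOPP
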